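/- arXiv:1409.8088 — 2 statements merged into one kernel-verified Lean document; each statement's English description precedes it below -/
import Mathlib

section
/- For every y>0 and every measurable function F:ℝ→ℂ, one has the identity (as an equality in [0,∞]): ∫_ℝ |ξ|·|F(yξ+ξ²)|² dξ = ∫_0^∞ |F(ζ)|² dζ + (y/2)·∫_0^{y²/4} ζ^{-1/2} |F(ζ − y²/4)|² dζ. -/
theorem cov_half_split (h : ℝ → ENNReal) :
    ∫⁻ x, h x = (∫⁻ t in Set.Ioi (0:ℝ), h t) + ∫⁻ t in Set.Ioi (0:ℝ), h (-t) := by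
  rw [← MeasureTheory.lintegral_add_compl h (measurableSet_Ioi (a := (0:ℝ)))]
  congr 1
  have := MeasureTheory.lintegral_image_eq_lintegral_abs_deriv_mul (s := Set.Ioi (0:ℝ))
    (f := fun x => -x) (f' := fun _ => -1) measurableSet_Ioi
    (fun x _ => (hasDerivAt_neg x).hasDerivWithinAt) (neg_injective.injOn) h
  simp only [Set.image_neg_eq_neg, Set.neg_Ioi, neg_zero, abs_neg, abs_one,
    ENNReal.ofReal_one, one_mul] at this
  rw [← this, Set.compl_Ioi]
  exact MeasureTheory.setLIntegral_congr MeasureTheory.Iio_ae_eq_Iic.symm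

open MeasureTheory Real
open scoped ENNReal NNReal

/-- exact change-of-variables identity for the Schrödinger phase
`yξ + ξ²` (case `a = 2`), as an equality in `[0,∞]`. -/
theorem change_of_variables_identity_a_two (y : ℝ) (hy : 0 < y)
    (F : ℝ → ℂ) (hF : Measurable F) :
    (∫⁻ ξ : ℝ, ENNReal.ofReal |ξ| * (‖F (y * ξ + ξ ^ 2)‖₊ : ℝ≥0∞) ^ 2)
      = (∫⁻ ζ in Set.Ioi (0:ℝ), (‖F ζ‖₊ : ℝ≥0∞) ^ 2)
        + ENNReal.ofReal (y / 2) *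
            ∫⁻ ζ in Set.Ioo (0:ℝ) (y^2/4),
              ENNReal.ofReal (ζ ^ (-(1/2) : ℝ)) * (‖F (ζ - y^2/4)‖₊ : ℝ≥0∞) ^ 2 := by
  obtain ⟨G, hG⟩ : ∃ G : ℝ → ℝ≥0∞, G = fun ζ => (‖F ζ‖₊ : ℝ≥0∞) ^ 2 := ⟨_, rfl⟩
  have hGm : Measurable G := by rw [hG]; fun_prop
  have e : ∀ z, (‖F z‖₊ : ℝ≥0∞) ^ 2 = G z := fun z => by rw [hG]
  simp only [e]
  clear e hG
  rw [← lintegral_sub_right_eq_self _ (y/2), cov_half_split, ← lintegral_add_left (by fun_prop)]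
  have h1 : ∀ t : ℝ, ENNReal.ofReal |t - y/2| * G (y * (t - y/2) + (t - y/2)^2)
      + ENNReal.ofReal |-t - y/2| * G (y * (-t - y/2) + (-t - y/2)^2)
      = ENNReal.ofReal (|t - y/2| + |t + y/2|) * G (t^2 - y^2/4) := by
    intro t
    rw [show y * (t - y/2) + (t - y/2)^2 = t^2 - y^2/4 by ring,
      show y * (-t - y/2) + (-t - y/2)^2 = t^2 - y^2/4 by ring,
      show -t - y/2 = -(t + y/2) by ring, abs_neg,
      ENNReal.ofReal_add (abs_nonneg _) (abs_nonneg _), add_mul]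
  simp only [h1]
  rw [← Set.Ioc_union_Ioi_eq_Ioi (show (0:ℝ) ≤ y/2 by positivity),
    lintegral_union measurableSet_Ioi
      (Set.Ioc_disjoint_Ioi le_rfl), add_comm]
  congr 1
  · have i1 : (fun t : ℝ => t^2 - y^2/4) '' Set.Ioi (y/2) = Set.Ioi 0 := by
      ext z
      simp only [Set.mem_image, Set.mem_Ioi]
      constructor
      · rintro ⟨t, ht, rfl⟩; nlinarith
      · intro hz
        refine ⟨√(z + y^2/4), Real.lt_sqrt_of_sq_lt (by nlinarith), ?_⟩
        rw [Real.sq_sqrt (by positivity)]; ring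
    have := lintegral_image_eq_lintegral_abs_deriv_mul (s := Set.Ioi (y/2))
      (f := fun t => t^2 - y^2/4) (f' := fun t => 2 * t) measurableSet_Ioi
      (fun x _ => by
        simpa using (((hasDerivAt_id x).pow 2).sub_const (y^2/4)).hasDerivWithinAt)
      (by
        intro a ha b hb hab
        simp only [Set.mem_Ioi] at ha hb hab
        nlinarith [mul_self_eq_mul_self_iff.mp (show a * a = b * b by nlinarith)]) G
    rw [i1] at this
    rw [Set.Ioc_union_Ioi_eq_Ioi (show (0:ℝ) ≤ y/2 by positivity), this]
    refine setLIntegral_congr_fun measurableSet_Ioi fun t ht => ?_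
    simp only [Set.mem_Ioi] at ht
    rw [abs_of_pos (by linarith : 0 < t - y/2), abs_of_pos (by linarith : 0 < t + y/2),
      abs_of_pos (by linarith : 0 < 2 * t)]
    congr 2; ring
  · have i1 : (fun t : ℝ => t^2) '' Set.Ioo 0 (y/2) = Set.Ioo 0 (y^2/4) := by
      ext z
      simp only [Set.mem_image, Set.mem_Ioo]
      constructor
      · rintro ⟨t, ⟨ht, ht'⟩, rfl⟩; constructor <;> nlinarith
      · rintro ⟨hz, hz'⟩
        refine ⟨√z, ⟨Real.sqrt_pos.2 hz, ?_⟩, Real.sq_sqrt hz.le⟩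
        rw [Real.sqrt_lt' (by positivity)]; nlinarith
    have := lintegral_image_eq_lintegral_abs_deriv_mul (s := Set.Ioo 0 (y/2))
      (f := fun t => t^2) (f' := fun t => 2 * t) measurableSet_Ioo
      (fun x _ => by
        simpa using (hasDerivAt_pow 2 x).hasDerivWithinAt)
      (by
        intro a ha b hb hab
        simp only [Set.mem_Ioo] at ha hb hab
        exact (pow_left_inj₀ ha.1.le hb.1.le two_ne_zero).1 hab)
      (fun ζ => ENNReal.ofReal (ζ ^ (-(1/2) : ℝ)) * G (ζ - y^2/4))
    rw [i1] at this
    rw [this, ← lintegral_const_mul _ (by fun_prop), setLIntegral_congr Ioo_ae_eq_Ioc.symm]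
    refine setLIntegral_congr_fun measurableSet_Ioo fun t ht => ?_
    obtain ⟨h0, ht⟩ := ht
    rw [abs_of_neg (by linarith : t - y/2 < 0), abs_of_pos (by linarith : 0 < t + y/2),
      abs_of_pos (by linarith : 0 < 2 * t), ← mul_assoc, ← mul_assoc,
      ← ENNReal.ofReal_mul (by positivity), ← ENNReal.ofReal_mul (by positivity)]
    congr 2
    have : (t^2) ^ (-(1/2) : ℝ) = t⁻¹ := by
      rw [Real.rpow_neg (by positivity), ← Real.sqrt_eq_rpow, Real.sqrt_sq h0.le]
    rw [this]; field_simp; ring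
end

section
/- Let M > 4 be an integer and let δ>0 satisfy δ + 1/M ≤ π/64. Let φ∈C_0^∞(ℝ) with φ ≥ 0 and supp φ ⊆ (−1/M, 1/M). Define φ̂(ξ) = ∫_ℝ e^{−ixξ} φ(x) dx, h(ξ) = sgn(ξ)·|ξ|^{-1/2}·φ̂(ξ), and u(t,x) = ∫_ℝ e^{i(xξ + t|ξ|^{1/2})} h(ξ) dξ. Then for every t>0 and every y∈ℝ with 1/t ≤ |y| ≤ δ, one has |u(t, y t²)| ≥ (√π / 2)·∫_ℝ t·φ(t² z)·|y−z|^{-1/2} dz. -/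
open MeasureTheory Real

lemma slb_int (b c : ℂ) (hb : b.re < 0) :
    Integrable (fun s : ℝ => Complex.exp (b * (s:ℂ)^2 + c * s)) := by
  simpa using integrable_cexp_quadratic' hb c 0

lemma slb_tail (t v : ℝ) (ht : 0 < t) (hv : 0 < v) :
    IntegrableOn (fun s : ℝ => 2 * v / (t + 2 * v * s)^2) (Set.Ioi 0) ∧
    ∫ s in Set.Ioi (0:ℝ), 2 * v / (t + 2 * v * s)^2 = 1 / t := by
  have hd : ∀ x ∈ Set.Ici (0:ℝ), HasDerivAt (fun s : ℝ => -(t + 2 * v * s)⁻¹)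
      (2 * v / (t + 2 * v * x)^2) x := by
    intro x hx
    have hx : 0 ≤ x := hx
    have h0 : t + 2 * v * x ≠ 0 := by positivity
    have h1 : HasDerivAt (fun s : ℝ => t + 2 * v * s) (2 * v) x := by
      simpa using ((hasDerivAt_id x).const_mul (2 * v)).const_add t
    refine (h1.inv h0).neg.congr_deriv ?_
    ring
  have hp : ∀ x ∈ Set.Ioi (0:ℝ), 0 ≤ 2 * v / (t + 2 * v * x)^2 := by
    intro x hx; positivity
  have hl : Filter.Tendsto (fun s : ℝ => -(t + 2 * v * s)⁻¹) Filter.atTop (nhds 0) := by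
    rw [← neg_zero]
    refine Filter.Tendsto.neg (Filter.Tendsto.inv_tendsto_atTop ?_)
    exact Filter.tendsto_atTop_add_const_left _ _
      (Filter.Tendsto.const_mul_atTop (by positivity) Filter.tendsto_id)
  refine ⟨integrableOn_Ioi_deriv_of_nonneg' hd hp hl, ?_⟩
  rw [integral_Ioi_of_hasDerivAt_of_nonneg' hd hp hl]
  simp

lemma slb_A (t v ε : ℝ) (ht : 0 < t) (hv : 0 < v) (hε : 0 < ε) :
    ‖∫ s in Set.Ioi (0:ℝ), Complex.exp ((-ε + v * Complex.I) * (s:ℂ)^2 + (t * Complex.I) * s)‖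
      ≤ (2 + ε / v) / t := by
  set b : ℂ := -ε + v * Complex.I with hb
  set c : ℂ := t * Complex.I with hc
  have hre : b.re < 0 := by simp [hb, hε]
  have hI := slb_int b c hre
  set g : ℝ → ℂ := fun s => 2 * b * s + c with hg
  have hgn : ∀ s : ℝ, 0 ≤ s → t + 2 * v * s ≤ ‖g s‖ := by
    intro s hs
    have : (g s).im = t + 2 * v * s := by simp [hg, hb, hc]; ring
    rw [← this]; exact (le_abs_self _).trans (Complex.abs_im_le_norm _)
  have hg0 : ∀ s : ℝ, 0 ≤ s → g s ≠ 0 := by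
    intro s hs h
    have := hgn s hs
    rw [h, norm_zero] at this
    have : 0 < t + 2 * v * s := by positivity
    linarith
  have hbn : ‖b‖ ≤ ε + v := by
    refine (norm_add_le _ _).trans ?_
    simp [abs_of_pos hε, abs_of_pos hv]
  obtain ⟨hTi, hT⟩ := slb_tail t v ht hv
  have hEn : ∀ s : ℝ, ‖Complex.exp (b * (s:ℂ)^2 + c * s)‖ = Real.exp (-ε * s^2) := by
    intro s
    rw [Complex.norm_exp]; congr 1
    simp [hb, hc, pow_two]
  set r : ℝ → ℂ := fun s => Complex.exp (b * (s:ℂ)^2 + c * s) * (2 * b) / (g s)^2 with hr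
  have hrb : ∀ s : ℝ, 0 < s → ‖r s‖ ≤ ((ε + v) / v) * (2 * v / (t + 2 * v * s)^2) := by
    intro s hs
    have h1 := hgn s hs.le
    have h2 : 0 < t + 2 * v * s := by positivity
    have h3 : Real.exp (-ε * s^2) ≤ 1 := by
      rw [Real.exp_le_one_iff]; nlinarith [sq_nonneg s]
    rw [hr]
    simp only [norm_div, norm_mul, norm_pow, hEn, Complex.norm_ofNat]
    calc Real.exp (-ε * s^2) * (2 * ‖b‖) / ‖g s‖^2 ≤ 1 * (2 * (ε + v)) / (t + 2 * v * s)^2 := by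
          gcongr
      _ = _ := by field_simp
  have hrc : ContinuousOn r (Set.Ioi 0) := by
    intro s hs
    have := hg0 s (le_of_lt hs)
    apply ContinuousAt.continuousWithinAt
    have hgc : Continuous g := by rw [hg]; fun_prop
    rw [hr]
    refine ContinuousAt.div (by fun_prop) (by fun_prop) (pow_ne_zero _ this)
  have hri : IntegrableOn r (Set.Ioi 0) := by
    refine Integrable.mono' (hTi.const_mul ((ε + v) / v)) (hrc.aestronglyMeasurable measurableSet_Ioi) ?_
    refine (ae_restrict_iff' measurableSet_Ioi).2 (Filter.Eventually.of_forall fun s hs => hrb s hs)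
  have hd : ∀ s ∈ Set.Ici (0:ℝ), HasDerivAt
      (fun s : ℝ => Complex.exp (b * (s:ℂ)^2 + c * s) / g s)
      (Complex.exp (b * (s:ℂ)^2 + c * s) - r s) s := by
    intro s hs
    have h0 := hg0 s hs
    have ho : HasDerivAt (fun s : ℝ => (s:ℂ)) 1 s := Complex.ofRealCLM.hasDerivAt
    have h1 : HasDerivAt g (2 * b) s := by
      exact ((ho.const_mul (2 * b)).add_const c).congr_deriv (by ring)
    have h2 : HasDerivAt (fun s : ℝ => b * (s:ℂ)^2 + c * s) (g s) s := by
      refine (((ho.pow 2).const_mul b).add (ho.const_mul c)).congr_deriv ?_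
      simp [hg]; ring
    refine (h2.cexp.div h1 h0).congr_deriv ?_
    simp only [hr]
    field_simp
  have hlim : Filter.Tendsto (fun s : ℝ => Complex.exp (b * (s:ℂ)^2 + c * s) / g s)
      Filter.atTop (nhds 0) := by
    have hl : Filter.Tendsto (fun s : ℝ => (t + 2 * v * s)⁻¹) Filter.atTop (nhds 0) := by
      refine (Filter.Tendsto.inv_tendsto_atTop ?_)
      exact Filter.tendsto_atTop_add_const_left _ _
        (Filter.Tendsto.const_mul_atTop (by positivity) Filter.tendsto_id)
    refine squeeze_zero_norm' ?_ hl
    filter_upwards [Filter.eventually_gt_atTop 0] with s hs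
    have h1 := hgn s hs.le
    have h2 : 0 < t + 2 * v * s := by positivity
    have h3 : Real.exp (-ε * s^2) ≤ 1 := by
      rw [Real.exp_le_one_iff]; nlinarith [sq_nonneg s]
    rw [norm_div, hEn, inv_eq_one_div]
    gcongr
  have key := integral_Ioi_of_hasDerivAt_of_tendsto' hd (hI.integrableOn.sub hri) hlim
  rw [integral_sub hI.integrableOn hri] at key
  have e : (∫ s in Set.Ioi (0:ℝ), Complex.exp (b * (s:ℂ)^2 + c * s))
     = (∫ s in Set.Ioi (0:ℝ), r s) - 1 / c := by
    have : Complex.exp (b * ((0:ℝ):ℂ)^2 + c * (0:ℝ)) / g 0 = 1 / c := by simp [hg]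
    rw [this] at key
    linear_combination key
  rw [e]
  have hc' : ‖(1:ℂ) / c‖ = 1 / t := by simp [hc, abs_of_pos ht]
  have hr' : ‖∫ s in Set.Ioi (0:ℝ), r s‖ ≤ ((ε + v) / v) * (1 / t) := by
    rw [← hT, ← integral_const_mul]
    refine norm_integral_le_of_norm_le (hTi.const_mul _) ?_
    refine (ae_restrict_iff' measurableSet_Ioi).2 (Filter.Eventually.of_forall fun s hs => hrb s hs)
  refine (norm_sub_le _ _).trans ?_
  rw [hc']
  refine (add_le_add_left hr' _).trans (le_of_eq ?_)
  field_simp; ring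

/-- half-line kernel -/
noncomputable def slbK (t ε v : ℝ) : ℂ :=
  2 * ((∫ s in Set.Ioi (0:ℝ), Complex.exp ((-ε + v * Complex.I) * (s:ℂ)^2 + (t * Complex.I) * s))
   - ∫ s in Set.Ioi (0:ℝ), Complex.exp ((-ε - v * Complex.I) * (s:ℂ)^2 + (t * Complex.I) * s))

noncomputable def slbF (t ε v : ℝ) : ℂ :=
  (π / (ε + v * Complex.I)) ^ (1 / 2 : ℂ) * Complex.exp (-t ^ 2 / (4 * (ε + v * Complex.I)))

lemma slbK_neg (t ε v : ℝ) : slbK t ε (-v) = - slbK t ε v := by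
  unfold slbK
  push_cast
  simp only [neg_mul, sub_neg_eq_add, ← sub_eq_add_neg]
  ring

lemma slbK_bound (t v ε : ℝ) (ht : 0 < t) (hv : 0 < v) (hε : 0 < ε) :
    ‖slbK t ε v + 2 * slbF t ε v‖ ≤ 4 * ((2 + ε / v) / t) := by
  set A := ∫ s in Set.Ioi (0:ℝ), Complex.exp ((-ε + v * Complex.I) * (s:ℂ)^2 + (t * Complex.I) * s) with hA
  have h1 := slb_A t v ε ht hv hε
  rw [← hA] at h1
  have hb : (-ε - v * Complex.I : ℂ).re < 0 := by simp [hε]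
  have hF : slbF t ε v = ∫ s : ℝ, Complex.exp ((-ε - v * Complex.I) * (s:ℂ)^2 + (t * Complex.I) * s) := by
    have := integral_cexp_quadratic hb (t * Complex.I) 0
    simp only [add_zero] at this
    rw [this, slbF]
    congr 2
    · ring
    · rw [mul_pow, Complex.I_sq, show (-ε - v * Complex.I : ℂ) = -(ε + v * Complex.I) by ring]
      simp only [mul_neg, div_neg, mul_one]; ring
  have hi := slb_int _ (t * Complex.I) hb
  have hc : ∫ s in Set.Iic (0:ℝ), Complex.exp ((-ε - v * Complex.I) * (s:ℂ)^2 + (t * Complex.I) * s)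
      = (starRingEnd ℂ) A := by
    rw [hA, ← integral_conj]
    have := integral_comp_neg_Ioi 0 (fun s : ℝ => Complex.exp ((-ε - v * Complex.I) * (s:ℂ)^2 + (t * Complex.I) * s))
    rw [neg_zero] at this
    rw [← this]
    congr 1; ext s
    rw [← Complex.exp_conj]
    congr 1
    simp only [map_add, map_mul, map_neg, map_pow, Complex.conj_ofReal, Complex.conj_I]
    push_cast
    ring
  have hs := intervalIntegral.integral_Iic_add_Ioi (b := 0) hi.integrableOn hi.integrableOn
  rw [hc, ← hF] at hs
  have : slbK t ε v + 2 * slbF t ε v = 2 * A + 2 * (starRingEnd ℂ) A := by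
    unfold slbK; rw [← hA]; linear_combination (-2) * hs
  rw [this]
  refine (norm_add_le _ _).trans ?_
  simp only [norm_mul, RCLike.norm_conj, Complex.norm_ofNat]
  linarith

lemma slb_weight (ε : ℝ) (hε : 0 < ε) :
    Integrable (fun ξ : ℝ => |ξ| ^ (-(1/2) : ℝ) * Real.exp (-ε * |ξ|)) := by
  have h := integrableOn_rpow_mul_exp_neg_mul_rpow (p := 1) (s := -(1/2)) (b := ε) (by norm_num) one_pos hε
  simp only [Real.rpow_one] at h
  have h1 : IntegrableOn (fun ξ : ℝ => |ξ| ^ (-(1/2) : ℝ) * Real.exp (-ε * |ξ|)) (Set.Ioi 0) := by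
    refine h.congr_fun (fun x hx => ?_) measurableSet_Ioi
    rw [abs_of_pos hx]
  have h2 : IntegrableOn (fun ξ : ℝ => |ξ| ^ (-(1/2) : ℝ) * Real.exp (-ε * |ξ|)) (Set.Iic 0) := by
    have := ((integrableOn_Ici_iff_integrableOn_Ioi (by simp)).2 h1).comp_neg
    simpa using this
  rw [← integrableOn_univ, ← Set.Iic_union_Ioi (a := (0:ℝ))]
  exact h2.union h1

/-- full kernel integrand -/
noncomputable def slbk (t ε v ξ : ℝ) : ℂ :=
  Complex.exp (Complex.I * ((v * ξ + t * |ξ| ^ ((1:ℝ)/2) : ℝ) : ℂ)) *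
    (((Real.sign ξ : ℝ) : ℂ) * ((|ξ| ^ (-(1/2) : ℝ) : ℝ) : ℂ)) * ((Real.exp (-ε * |ξ|) : ℝ) : ℂ)

lemma slb_sign (ξ : ℝ) : |Real.sign ξ| ≤ 1 := by
  rcases Real.sign_apply_eq ξ with h | h | h <;> simp [h]

lemma slb_sign_meas : Measurable Real.sign := by
  unfold Real.sign
  exact Measurable.ite measurableSet_Iio measurable_const
    (Measurable.ite measurableSet_Ioi measurable_const measurable_const)

lemma slbk_norm (t ε v ξ : ℝ) : ‖slbk t ε v ξ‖ ≤ |ξ| ^ (-(1/2) : ℝ) * Real.exp (-ε * |ξ|) := by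
  unfold slbk
  rw [norm_mul, norm_mul, norm_mul, mul_comm Complex.I, Complex.norm_exp_ofReal_mul_I]
  simp only [Complex.norm_real, Real.norm_eq_abs, abs_exp, one_mul]
  rw [abs_of_nonneg (show 0 ≤ |ξ| ^ (-(1/2) : ℝ) by positivity)]
  gcongr
  exact mul_le_of_le_one_left (by positivity) (slb_sign ξ)

lemma slbk_int (t ε v : ℝ) (hε : 0 < ε) : Integrable (slbk t ε v) := by
  refine (slb_weight ε hε).mono' ?_ (Filter.Eventually.of_forall (slbk_norm t ε v))
  apply Measurable.aestronglyMeasurable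
  have := slb_sign_meas
  unfold slbk
  fun_prop

lemma slbk_integral (t ε v : ℝ) (hε : 0 < ε) : ∫ ξ, slbk t ε v ξ = slbK t ε v := by
  have hi := slbk_int t ε v hε
  have hs := intervalIntegral.integral_Iic_add_Ioi (b := 0) hi.integrableOn hi.integrableOn
  rw [← hs]
  have hn := integral_comp_neg_Ioi 0 (slbk t ε v)
  rw [neg_zero] at hn
  rw [← hn, ← integral_comp_rpow_Ioi_of_pos (g := slbk t ε v) two_pos,
    ← integral_comp_rpow_Ioi_of_pos (g := fun x => slbk t ε v (-x)) two_pos]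
  unfold slbK
  rw [mul_sub, sub_eq_add_neg (2 * _), add_comm]
  rw [← integral_const_mul, ← integral_const_mul, ← integral_neg]
  have key : ∀ s : ℝ, 0 < s → s * |s^(2:ℝ)| ^ (-(1/2) : ℝ) = 1 ∧ |s^(2:ℝ)| ^ ((1:ℝ)/2) = s
      ∧ |s^(2:ℝ)| = s^2 ∧ Real.sign (s^2) = 1 := by
    intro s hs
    have h0 : |s^(2:ℝ)| = s^2 := by rw [Real.rpow_two, abs_of_pos (by positivity)]
    have h1 : (s^2) ^ ((1:ℝ)/2) = s := by
      rw [← Real.sqrt_eq_rpow, Real.sqrt_sq hs.le]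
    refine ⟨?_, ?_, h0, Real.sign_of_pos (by positivity)⟩
    · rw [h0, Real.rpow_neg (by positivity), h1]; field_simp
    · rw [h0, h1]
  congr 1
  · refine setIntegral_congr_fun measurableSet_Ioi (fun s hs => ?_)
    obtain ⟨k1, k2, k3, k4⟩ := key s hs
    have k1' : (s:ℂ) * ((|s^(2:ℝ)| ^ (-(1/2) : ℝ) : ℝ) : ℂ) = 1 := by exact_mod_cast k1
    simp only [slbk, k2]
    rw [k3] at k1' ⊢
    simp only [Real.rpow_two, k4, show (2:ℝ) - 1 = 1 by norm_num, Real.rpow_one]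
    rw [Complex.real_smul]
    push_cast
    rw [show ((-ε + v * Complex.I) * (s:ℂ)^2 + (t * Complex.I) * s) =
      Complex.I * (v * s ^2 + t * s) + -ε * s^2 by ring, Complex.exp_add]
    linear_combination (2 * Complex.exp (Complex.I * (v * s ^2 + t * s)) * Complex.exp (-ε * s^2)) * k1'
  · refine setIntegral_congr_fun measurableSet_Ioi (fun s hs => ?_)
    obtain ⟨k1, k2, k3, k4⟩ := key s hs
    have k1' : (s:ℂ) * ((|s^(2:ℝ)| ^ (-(1/2) : ℝ) : ℝ) : ℂ) = 1 := by exact_mod_cast k1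
    simp only [slbk, abs_neg, k2]
    rw [k3] at k1' ⊢
    simp only [Real.rpow_two, Real.sign_neg, k4, show (2:ℝ) - 1 = 1 by norm_num, Real.rpow_one]
    rw [Complex.real_smul]
    push_cast
    rw [show ((-ε - v * Complex.I) * (s:ℂ)^2 + (t * Complex.I) * s) =
      Complex.I * (v * -s ^2 + t * s) + -ε * s^2 by ring, Complex.exp_add]
    linear_combination (-2 * Complex.exp (Complex.I * (v * -s ^2 + t * s)) * Complex.exp (-ε * s^2)) * k1'

lemma slbF_bound (t ε v v0 : ℝ) (hε : 0 ≤ ε) (h0 : 0 < v0) (hv : v0 ≤ v) :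
    ‖slbF t ε v‖ ≤ (π / v0) ^ (1/2 : ℝ) := by
  have hvp : 0 < v := h0.trans_le hv
  set z : ℂ := ε + v * Complex.I with hz
  have him : z.im = v := by simp [hz]
  have hre : z.re = ε := by simp [hz]
  have hzn : v ≤ ‖z‖ := by
    rw [← him]; exact (le_abs_self _).trans (Complex.abs_im_le_norm _)
  have hz0 : z ≠ 0 := by
    intro h; rw [h] at him; simp at him; linarith
  have h1 : ‖((π:ℂ) / z) ^ (1 / 2 : ℂ)‖ = (π / ‖z‖) ^ (1/2:ℝ) := by
    rw [Complex.norm_cpow_of_ne_zero (div_ne_zero (by exact_mod_cast pi_ne_zero) hz0)]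
    have a : (1 / 2 : ℂ).re = 1/2 := by norm_num
    have b : (1 / 2 : ℂ).im = 0 := by norm_num
    rw [a, b]
    simp [abs_of_pos pi_pos]
  have h2 : ‖Complex.exp (-(t:ℂ) ^ 2 / (4 * z))‖ ≤ 1 := by
    rw [Complex.norm_exp, Real.exp_le_one_iff]
    have : -(t:ℂ) ^ 2 / (4 * z) = ((-(t^2/4) : ℝ) : ℂ) * z⁻¹ := by
      push_cast; field_simp
    rw [this, Complex.re_ofReal_mul, Complex.inv_re, hre]
    have : 0 ≤ ε / Complex.normSq z := div_nonneg hε (Complex.normSq_nonneg _)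
    nlinarith [sq_nonneg t]
  unfold slbF
  rw [← hz, norm_mul, h1]
  calc (π / ‖z‖) ^ (1/2:ℝ) * _ ≤ (π / v0) ^ (1/2 : ℝ) * 1 := by
        gcongr
        exact hv.trans hzn
    _ = _ := mul_one _

lemma slbF_zero (t v : ℝ) (hv : 0 < v) :
    slbF t 0 v = ((√π * v ^ (-(1/2) : ℝ) : ℝ) : ℂ) *
      Complex.exp (((t^2 / (4 * v) - π / 4 : ℝ) : ℂ) * Complex.I) := by
  unfold slbF
  have hv' : (v:ℂ) ≠ 0 := by exact_mod_cast hv.ne'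
  have e1 : (π:ℂ) / ((0:ℝ) + v * Complex.I) = ((π / v : ℝ) : ℂ) * (-Complex.I) := by
    push_cast
    rw [zero_add]
    field_simp
    simp
  have hr : 0 < π / v := by positivity
  have e2 : (((π / v : ℝ) : ℂ) * (-Complex.I)) ^ (1/2 : ℂ) =
      ((√π * v ^ (-(1/2) : ℝ) : ℝ) : ℂ) * Complex.exp (((- π / 4 : ℝ) : ℂ) * Complex.I) := by
    rw [Complex.cpow_def_of_ne_zero (mul_ne_zero (by exact_mod_cast hr.ne') (by simp)),
      Complex.log_ofReal_mul hr (by simp), Complex.log_neg_I]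
    have : √π * v ^ (-(1/2) : ℝ) = Real.exp (Real.log (π / v) * (1/2)) := by
      rw [← Real.rpow_def_of_pos hr, Real.div_rpow pi_pos.le hv.le, Real.sqrt_eq_rpow,
        Real.rpow_neg hv.le]
      rfl
    rw [this]
    push_cast
    rw [← Complex.exp_add]
    congr 1
    ring
  rw [e1, e2, mul_assoc, ← Complex.exp_add]
  congr 2
  push_cast
  field_simp
  rw [zero_add]
  field_simp
  simp only [Complex.I_sq]
  ring

lemma slbF_tendsto (t v : ℝ) (hv : 0 < v) :
    Filter.Tendsto (fun ε => slbF t ε v) (nhdsWithin 0 (Set.Ioi 0)) (nhds (slbF t 0 v)) := by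
  have : ContinuousAt (fun ε => slbF t ε v) 0 := by
    unfold slbF
    have hv' : (v:ℂ) ≠ 0 := by exact_mod_cast hv.ne'
    have h0 : (((0:ℝ):ℂ) + v * Complex.I) ≠ 0 := by simp [hv.ne']
    have e1 : (π:ℂ) / ((0:ℝ) + v * Complex.I) = ((π / v : ℝ) : ℂ) * (-Complex.I) := by
      push_cast
      rw [zero_add]
      field_simp
      simp
    refine ContinuousAt.mul (ContinuousAt.cpow (ContinuousAt.div (by fun_prop) (by fun_prop) h0)
      (by fun_prop) ?_) (ContinuousAt.cexp (ContinuousAt.div (by fun_prop) (by fun_prop) ?_))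
    · rw [e1]
      right
      rw [Complex.im_ofReal_mul]
      simp [pi_ne_zero, hv.ne']
    · exact mul_ne_zero (by norm_num) h0
  exact this.tendsto.mono_left nhdsWithin_le_nhds

noncomputable def slbHat (φ : ℝ → ℝ) (ξ : ℝ) : ℂ :=
  ∫ x : ℝ, Complex.exp (-(Complex.I * ((x * ξ : ℝ) : ℂ))) * (φ x : ℂ)

lemma slbHat_prop (φ : ℝ → ℝ) (hφs : ContDiff ℝ (⊤ : ℕ∞) φ) (hφc : HasCompactSupport φ) :
    Integrable (slbHat φ) ∧ Measurable (slbHat φ) ∧ ∃ C, ∀ ξ, ‖slbHat φ ξ‖ ≤ C := by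
  have h1 : HasCompactSupport (fun x => (φ x : ℂ)) := hφc.comp_left (g := Complex.ofReal) (by simp)
  have h2 : ContDiff ℝ (⊤ : ℕ∞) (fun x => (φ x : ℂ)) := Complex.ofRealCLM.contDiff.comp hφs
  set f : SchwartzMap ℝ ℂ := h1.toSchwartzMap h2 with hf
  have e : slbHat φ = fun ξ => (FourierTransform.fourier f) ((2 * π)⁻¹ * ξ) := by
    ext ξ
    rw [SchwartzMap.fourier_coe, Real.fourier_real_eq_integral_exp_smul]
    unfold slbHat
    congr 1; ext x
    rw [smul_eq_mul]
    have : f x = (φ x : ℂ) := rfl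
    rw [this]
    congr 2
    have hp : (π:ℂ) ≠ 0 := by exact_mod_cast pi_ne_zero
    push_cast
    field_simp
  refine ⟨?_, ?_, ?_⟩
  · rw [e]
    exact (FourierTransform.fourier f).integrable.comp_mul_left' (by positivity)
  · rw [e]
    exact ((FourierTransform.fourier f).continuous.comp (by fun_prop)).measurable
  · refine ⟨∫ x, ‖(φ x : ℂ)‖, fun ξ => ?_⟩
    unfold slbHat
    refine (norm_integral_le_integral_norm _).trans (le_of_eq ?_)
    congr 1; ext x
    rw [norm_mul, show -(Complex.I * ((x * ξ : ℝ) : ℂ)) = ((-(x*ξ) : ℝ) : ℂ) * Complex.I by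
      push_cast; ring, Complex.norm_exp_ofReal_mul_I, one_mul]

/-- the integrand of the theorem -/
noncomputable def slbG (φ : ℝ → ℝ) (t y ξ : ℝ) : ℂ :=
  Complex.exp (Complex.I * ((y * t^2 * ξ + t * |ξ| ^ ((1:ℝ)/2) : ℝ) : ℂ)) *
    (((Real.sign ξ : ℝ) : ℂ) * ((|ξ| ^ (-(1/2) : ℝ) : ℝ) : ℂ) * slbHat φ ξ)

lemma slbG_int (φ : ℝ → ℝ) (hφs : ContDiff ℝ (⊤ : ℕ∞) φ) (hφc : HasCompactSupport φ) (t y : ℝ) :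
    Integrable (slbG φ t y) := by
  obtain ⟨hi, hm, C, hC⟩ := slbHat_prop φ hφs hφc
  have hC0 : 0 ≤ C := (norm_nonneg _).trans (hC 0)
  refine (((slb_weight 1 one_pos).const_mul (C * Real.exp 1)).add hi.norm).mono' ?_
    (Filter.Eventually.of_forall fun ξ => ?_)
  · apply Measurable.aestronglyMeasurable
    have := slb_sign_meas
    unfold slbG
    fun_prop
  · have hw : 0 ≤ |ξ| ^ (-(1/2) : ℝ) := by positivity
    have h1 : ‖slbG φ t y ξ‖ ≤ |ξ| ^ (-(1/2) : ℝ) * ‖slbHat φ ξ‖ := by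
      unfold slbG
      rw [norm_mul, norm_mul, norm_mul, mul_comm Complex.I, Complex.norm_exp_ofReal_mul_I]
      simp only [Complex.norm_real, Real.norm_eq_abs, one_mul]
      rw [abs_of_nonneg hw]
      gcongr
      exact mul_le_of_le_one_left (by positivity) (slb_sign ξ)
    refine h1.trans ?_
    simp only [Pi.add_apply]
    rcases le_total |ξ| 1 with h | h
    · have : 1 ≤ Real.exp 1 * Real.exp (-1 * |ξ|) := by
        rw [← Real.exp_add]; apply Real.one_le_exp; linarith
      have h3 : |ξ| ^ (-(1/2) : ℝ) * ‖slbHat φ ξ‖ ≤ (|ξ| ^ (-(1/2) : ℝ) * C) * (Real.exp 1 * Real.exp (-1 * |ξ|)) := by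
        refine le_trans ?_ (le_mul_of_one_le_right (by positivity) this)
        gcongr; exact hC ξ
      have := norm_nonneg (slbHat φ ξ)
      linarith
    · have h3 : |ξ| ^ (-(1/2) : ℝ) ≤ 1 := Real.rpow_le_one_of_one_le_of_nonpos h (by norm_num)
      have h4 : |ξ| ^ (-(1/2) : ℝ) * ‖slbHat φ ξ‖ ≤ ‖slbHat φ ξ‖ :=
        mul_le_of_le_one_left (norm_nonneg _) h3
      have : 0 ≤ C * Real.exp 1 * (|ξ| ^ (-(1/2) : ℝ) * Real.exp (-1 * |ξ|)) := by positivity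
      linarith

lemma slbG_tendsto (φ : ℝ → ℝ) (hφs : ContDiff ℝ (⊤ : ℕ∞) φ) (hφc : HasCompactSupport φ) (t y : ℝ) :
    Filter.Tendsto (fun ε : ℝ => ∫ ξ, slbG φ t y ξ * ((Real.exp (-ε * |ξ|) : ℝ) : ℂ))
      (nhdsWithin 0 (Set.Ioi 0)) (nhds (∫ ξ, slbG φ t y ξ)) := by
  have hi := slbG_int φ hφs hφc t y
  refine tendsto_integral_filter_of_dominated_convergence (fun ξ => ‖slbG φ t y ξ‖) ?_ ?_ hi.norm ?_
  · refine Filter.Eventually.of_forall fun ε => hi.aestronglyMeasurable.mul ?_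
    apply Continuous.aestronglyMeasurable
    fun_prop
  · filter_upwards [self_mem_nhdsWithin] with ε hε
    refine Filter.Eventually.of_forall fun ξ => ?_
    rw [norm_mul, Complex.norm_real, Real.norm_eq_abs, abs_exp]
    refine mul_le_of_le_one_right (norm_nonneg _) ?_
    rw [Real.exp_le_one_iff]
    have : 0 < ε := hε
    nlinarith [abs_nonneg ξ]
  · refine Filter.Eventually.of_forall fun ξ => ?_
    have : Continuous fun ε : ℝ => slbG φ t y ξ * ((Real.exp (-ε * |ξ|) : ℝ) : ℂ) := by fun_prop
    have h := (this.tendsto 0).mono_left (nhdsWithin_le_nhds (s := Set.Ioi 0))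
    simpa using h

lemma slb_fubini (φ : ℝ → ℝ) (hφs : ContDiff ℝ (⊤ : ℕ∞) φ) (hφc : HasCompactSupport φ)
    (t y ε : ℝ) (hε : 0 < ε) :
    Integrable (fun x => slbK t ε (y * t^2 - x) * (φ x : ℂ)) ∧
    ∫ ξ, slbG φ t y ξ * ((Real.exp (-ε * |ξ|) : ℝ) : ℂ)
      = ∫ x, slbK t ε (y * t^2 - x) * (φ x : ℂ) := by
  have hφi : Integrable φ := hφs.continuous.integrable_of_hasCompactSupport hφc
  have hP : Integrable (Function.uncurry fun (x ξ : ℝ) => slbk t ε (y * t^2 - x) ξ * (φ x : ℂ))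
      (volume.prod volume) := by
    refine (hφi.norm.mul_prod (slb_weight ε hε)).mono' ?_ (Filter.Eventually.of_forall fun p => ?_)
    · apply Measurable.aestronglyMeasurable
      have := slb_sign_meas
      have := hφs.continuous.measurable
      unfold slbk Function.uncurry
      fun_prop
    · simp only [Function.uncurry]
      rw [norm_mul, Complex.norm_real, mul_comm]
      gcongr
      exact slbk_norm _ _ _ _
  have hint : ∀ x, ∫ ξ, slbk t ε (y * t^2 - x) ξ * (φ x : ℂ) = slbK t ε (y * t^2 - x) * (φ x : ℂ) := by
    intro x
    rw [integral_mul_const, slbk_integral _ _ _ hε]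
  constructor
  · have := hP.integral_prod_left
    simpa only [Function.uncurry, hint] using this
  · simp_rw [← hint]
    rw [integral_integral_swap hP]
    congr 1; ext ξ
    unfold slbG slbHat
    rw [← integral_const_mul, ← integral_const_mul, ← integral_mul_const]
    congr 1; ext x
    unfold slbk
    rw [show Complex.I * (((y * t^2 - x) * ξ + t * |ξ| ^ ((1:ℝ)/2) : ℝ) : ℂ) =
      Complex.I * ((y * t^2 * ξ + t * |ξ| ^ ((1:ℝ)/2) : ℝ) : ℂ) + -(Complex.I * ((x * ξ : ℝ) : ℂ)) by
        push_cast; ring, Complex.exp_add]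
    ring

lemma slb_core (φ : ℝ → ℝ) (hφs : ContDiff ℝ (⊤ : ℕ∞) φ) (hφc : HasCompactSupport φ)
    (hφ0 : ∀ x, 0 ≤ φ x) (t y σ m : ℝ) (ht : 1 ≤ t) (hσ : σ = 1 ∨ σ = -1) (hy : y = σ * |y|)
    (hyt : t ≤ |y| * t^2) (hm : m ≤ 1/5) (hφm : ∀ x, φ x ≠ 0 → |x| ≤ m)
    (hW : |y| * t^2 + m ≤ t^2 * (π/64)) :
    √π / 2 * ∫ x, φ x * |y * t^2 - x| ^ (-(1/2) : ℝ) ≤ ‖∫ ξ, slbG φ t y ξ‖ := by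
  have ht0 : 0 < t := by linarith
  have hφi : Integrable φ := hφs.continuous.integrable_of_hasCompactSupport hφc
  have hφm' : Measurable φ := hφs.continuous.measurable
  set W : ℝ → ℝ := fun x => |y| * t^2 - σ * x with hWdef
  have hWx : ∀ x, y * t^2 - x = σ * W x := by
    intro x; simp only [hWdef]
    rcases hσ with h | h <;> rw [h] at hy ⊢ <;> nth_rewrite 1 [hy] <;> ring
  have hσx : ∀ x, |σ * x| = |x| := by
    intro x; rcases hσ with h | h <;> simp [h]
  have hWl : ∀ x, φ x ≠ 0 → t / 2 ≤ W x := by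
    intro x hx
    have h1 := hφm x hx
    have h2 := le_abs_self (σ * x)
    rw [hσx] at h2
    simp only [hWdef]; linarith
  have hWu : ∀ x, φ x ≠ 0 → W x ≤ t^2 * (π/64) := by
    intro x hx
    have h1 := hφm x hx
    have h2 := neg_abs_le (σ * x)
    rw [hσx] at h2
    simp only [hWdef]; linarith
  have hFm : ∀ ε, Measurable (fun x => slbF t ε (W x)) := by
    intro ε; unfold slbF; simp only [hWdef]; fun_prop
  set C : ℝ := (π / (t/2)) ^ (1/2 : ℝ) with hC
  have hFb : ∀ ε, 0 ≤ ε → ∀ x, ‖slbF t ε (W x) * (φ x : ℂ)‖ ≤ C * φ x := by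
    intro ε hε x
    rw [norm_mul, Complex.norm_real, Real.norm_eq_abs, abs_of_nonneg (hφ0 x)]
    by_cases hx : φ x = 0
    · simp [hx]
    · exact mul_le_mul_of_nonneg_right (slbF_bound t ε _ _ hε (by positivity) (hWl x hx)) (hφ0 x)
  have hFae : ∀ ε, AEStronglyMeasurable (fun x => slbF t ε (W x) * (φ x : ℂ)) := by
    intro ε
    have := hFm ε
    exact (this.mul (by fun_prop)).aestronglyMeasurable
  have hFi : ∀ ε, 0 ≤ ε → Integrable (fun x => slbF t ε (W x) * (φ x : ℂ)) := fun ε hε =>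
    (hφi.const_mul C).mono' (hFae ε) (Filter.Eventually.of_forall (hFb ε hε))
  -- limit of the main term
  have hFlim : Filter.Tendsto (fun ε => ∫ x, slbF t ε (W x) * (φ x : ℂ))
      (nhdsWithin 0 (Set.Ioi 0)) (nhds (∫ x, slbF t 0 (W x) * (φ x : ℂ))) := by
    refine tendsto_integral_filter_of_dominated_convergence (fun x => C * φ x)
      (Filter.Eventually.of_forall hFae) ?_ (hφi.const_mul C) ?_
    · filter_upwards [self_mem_nhdsWithin] with ε hε
      exact Filter.Eventually.of_forall (hFb ε (le_of_lt hε))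
    · refine Filter.Eventually.of_forall fun x => ?_
      by_cases hx : φ x = 0
      · simp [hx]
      · exact (slbF_tendsto t (W x) (by have := hWl x hx; linarith)).mul_const _
  -- inequality for each ε
  have hstep : ∀ ε, 0 < ε → ε ≤ t / 4 →
      2 * ‖∫ x, slbF t ε (W x) * (φ x : ℂ)‖ - 10 / t * ∫ x, φ x ≤
        ‖∫ ξ, slbG φ t y ξ * ((Real.exp (-ε * |ξ|) : ℝ) : ℂ)‖ := by
    intro ε hε hεt
    obtain ⟨hKi, hU⟩ := slb_fubini φ hφs hφc t y ε hε
    have hKσ : ∀ x, slbK t ε (y * t^2 - x) = σ * slbK t ε (W x) := by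
      intro x; rw [hWx]
      rcases hσ with h | h
      · simp [h]
      · simp [h, slbK_neg]
    have hσn : ‖(σ:ℂ)‖ = 1 := by rcases hσ with h | h <;> simp [h]
    have hσ0 : (σ:ℂ) ≠ 0 := by intro h; simp [h] at hσn
    have hKi' : Integrable (fun x => slbK t ε (W x) * (φ x : ℂ)) := by
      refine (hKi.const_mul ((σ:ℂ)⁻¹)).congr (Filter.Eventually.of_forall fun x => ?_)
      simp only [hKσ]; field_simp
    have hU' : ‖∫ ξ, slbG φ t y ξ * ((Real.exp (-ε * |ξ|) : ℝ) : ℂ)‖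
        = ‖∫ x, slbK t ε (W x) * (φ x : ℂ)‖ := by
      rw [hU]; simp_rw [hKσ, mul_assoc]
      rw [integral_const_mul, norm_mul, hσn, one_mul]
    rw [hU']
    have hsum : ‖(∫ x, slbK t ε (W x) * (φ x : ℂ)) + 2 * ∫ x, slbF t ε (W x) * (φ x : ℂ)‖
        ≤ 10 / t * ∫ x, φ x := by
      rw [← integral_const_mul, ← integral_const_mul, ← integral_add hKi' ((hFi ε hε.le).const_mul 2)]
      refine norm_integral_le_of_norm_le (hφi.const_mul _) (Filter.Eventually.of_forall fun x => ?_)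
      rw [← mul_assoc, ← add_mul, norm_mul, Complex.norm_real, Real.norm_eq_abs,
        abs_of_nonneg (hφ0 x)]
      by_cases hx : φ x = 0
      · simp [hx]
      · refine mul_le_mul_of_nonneg_right ?_ (hφ0 x)
        have hw := hWl x hx
        have hw0 : 0 < W x := by linarith
        refine (slbK_bound t (W x) ε ht0 hw0 hε).trans ?_
        have : ε / W x ≤ 1/2 := by rw [div_le_iff₀ hw0]; linarith
        rw [← mul_div_assoc]
        gcongr
        linarith
    have h2 : 2 * ‖∫ x, slbF t ε (W x) * (φ x : ℂ)‖ = ‖2 * ∫ x, slbF t ε (W x) * (φ x : ℂ)‖ := by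
      rw [norm_mul, Complex.norm_ofNat]
    rw [h2]
    set a := ∫ x, slbK t ε (W x) * (φ x : ℂ)
    set b := 2 * ∫ x, slbF t ε (W x) * (φ x : ℂ)
    have : ‖b‖ ≤ ‖a + b‖ + ‖a‖ := by
      have := norm_sub_le (a + b) a
      rwa [add_sub_cancel_left] at this
    linarith
  have hlim := le_of_tendsto_of_tendsto ((hFlim.norm.const_mul 2).sub_const (10 / t * ∫ x, φ x))
    (slbG_tendsto φ hφs hφc t y).norm (by
      have : Set.Ioc (0:ℝ) (t/4) ∈ nhdsWithin (0:ℝ) (Set.Ioi 0) :=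
        Ioc_mem_nhdsGT (by positivity)
      filter_upwards [this] with ε hε
      exact hstep ε hε.1 hε.2)
  refine le_trans ?_ hlim
  -- the main term
  set W0 : ℝ := |y| * t^2 with hW0
  have hW0p : 0 < W0 := by linarith
  set c : ℂ := Complex.exp ((-(t^2 / (4 * W0) - π / 4) : ℝ) * Complex.I) with hc
  have hcn : ‖c‖ = 1 := Complex.norm_exp_ofReal_mul_I _
  have hre : ∀ x, φ x ≠ 0 → 7/8 * (√π * |W x| ^ (-(1/2) : ℝ)) ≤ (c * slbF t 0 (W x)).re := by
    intro x hx
    have hw := hWl x hx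
    have hw0 : 0 < W x := by linarith
    rw [slbF_zero t _ hw0, abs_of_pos hw0, hc, mul_left_comm (Complex.exp _), ← Complex.exp_add, ← add_mul,
      ← Complex.ofReal_add, Complex.re_ofReal_mul, Complex.exp_ofReal_mul_I_re, mul_comm (7/8 : ℝ)]
    gcongr
    set θ := -(t^2 / (4 * W0) - π / 4) + (t^2 / (4 * W x) - π / 4) with hθ
    have hθe : θ = t^2 * (σ * x) / (4 * W0 * W x) := by
      rw [hθ]
      have : σ * x = W0 - W x := by simp only [hWdef]; ring
      rw [this]; field_simp; ring
    have hθb : |θ| ≤ 1/10 := by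
      rw [hθe, abs_div, abs_mul, hσx, abs_of_pos (show 0 < 4 * W0 * W x by positivity),
        abs_of_pos (show 0 < t^2 by positivity), div_le_iff₀ (by positivity)]
      have h1 : |x| ≤ 1/5 := (hφm x hx).trans hm
      have h2 : t * (t/2) ≤ W0 * W x := mul_le_mul hyt hw (by positivity) hW0p.le
      nlinarith [sq_nonneg t]
    have h3 := Real.one_sub_sq_div_two_le_cos (x := θ)
    have h4 : θ^2 ≤ (1/10)^2 := by rw [← sq_abs]; gcongr
    linarith
  set H : ℝ → ℝ := fun x => φ x * (√π * |W x| ^ (-(1/2) : ℝ)) with hH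
  have hHt : ∀ x, 10 / t * φ x ≤ 5/4 * H x := by
    intro x
    by_cases hx : φ x = 0
    · simp [hH, hx]
    · have hw := hWl x hx
      have hu := hWu x hx
      have hw0 : 0 < W x := by linarith
      have : 1 / t * 8 ≤ √π * |W x| ^ (-(1/2) : ℝ) := by
        rw [abs_of_pos hw0, Real.rpow_neg hw0.le, ← Real.sqrt_eq_rpow]
        have hs : √(W x) ≤ t * √π / 8 := by
          rw [Real.sqrt_le_left (by positivity)]
          rw [div_pow, mul_pow, Real.sq_sqrt pi_pos.le]; linarith
        have hsp : 0 < √(W x) := Real.sqrt_pos.2 hw0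
        rw [← div_eq_mul_inv, le_div_iff₀ hsp, one_div, mul_assoc, inv_mul_le_iff₀ ht0]
        linarith
      have h2 := mul_le_mul_of_nonneg_left this (hφ0 x)
      simp only [hH]
      have e : 10 / t * φ x = 5/4 * (φ x * (1 / t * 8)) := by ring
      rw [e]; linarith
  have hRi : Integrable (fun x => (c * (slbF t 0 (W x) * (φ x : ℂ))).re) :=
    ((hFi 0 le_rfl).const_mul c).re
  have hHR : ∀ x, 7/8 * H x ≤ (c * (slbF t 0 (W x) * (φ x : ℂ))).re := by
    intro x
    by_cases hx : φ x = 0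
    · simp [hH, hx]
    · rw [← mul_assoc c, mul_comm _ (φ x : ℂ), Complex.re_ofReal_mul]
      have := mul_le_mul_of_nonneg_left (hre x hx) (hφ0 x)
      simp only [hH]; linarith
  have hH0 : ∀ x, 0 ≤ H x := fun x => by
    have := hφ0 x
    simp only [hH]; positivity
  have hHi : Integrable H := by
    refine (hRi.const_mul (8/7)).mono' ?_ (Filter.Eventually.of_forall fun x => ?_)
    · apply Measurable.aestronglyMeasurable
      simp only [hH, hWdef]; fun_prop
    · rw [Real.norm_eq_abs, abs_of_nonneg (hH0 x)]
      have := hHR x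
      linarith
  have i1 : 7/8 * ∫ x, H x ≤ ‖∫ x, slbF t 0 (W x) * (φ x : ℂ)‖ := by
    rw [← integral_const_mul]
    refine (integral_mono (hHi.const_mul _) hRi hHR).trans ?_
    have := integral_re ((hFi 0 le_rfl).const_mul c)
    simp only [RCLike.re_to_complex] at this
    rw [this, integral_const_mul]
    refine (Complex.re_le_norm _).trans ?_
    rw [norm_mul, hcn, one_mul]
  have i2 : 10 / t * ∫ x, φ x ≤ 5/4 * ∫ x, H x := by
    rw [← integral_const_mul, ← integral_const_mul]
    exact integral_mono (hφi.const_mul _) (hHi.const_mul _) hHt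
  have i3 : √π / 2 * ∫ x, φ x * |y * t^2 - x| ^ (-(1/2) : ℝ) = 1/2 * ∫ x, H x := by
    rw [← integral_const_mul, ← integral_const_mul]
    congr 1; ext x
    rw [hWx, hσx]; simp only [hH]; ring
  rw [i3]
  linarith

/-- sharp lower bound for low-frequency data with a square-root
singularity at frequency zero. -/
theorem sharp_lower_bound_low_frequency (M : ℕ) (hM : 4 < M)
    (δ : ℝ) (hδ : 0 < δ) (hMδ : δ + 1/(M:ℝ) ≤ Real.pi/64)
    (φ : ℝ → ℝ) (hφs : ContDiff ℝ (⊤ : ℕ∞) φ) (hφc : HasCompactSupport φ)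
    (hφ0 : ∀ x, 0 ≤ φ x) (hsupp : tsupport φ ⊆ Set.Ioo (-(1/(M:ℝ))) (1/(M:ℝ))) :
    ∀ t : ℝ, 0 < t → ∀ y : ℝ, 1/t ≤ |y| → |y| ≤ δ →
      Real.sqrt Real.pi / 2 * (∫ z : ℝ, t * φ (t^2 * z) * |y - z| ^ (-(1/2) : ℝ))
        ≤ ‖∫ ξ : ℝ, Complex.exp (Complex.I *
              ((y * t^2 * ξ + t * |ξ| ^ ((1:ℝ)/2) : ℝ) : ℂ)) *
            (((Real.sign ξ : ℝ) : ℂ) * ((|ξ| ^ (-(1/2) : ℝ) : ℝ) : ℂ) *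
              ∫ x : ℝ, Complex.exp (-(Complex.I * ((x * ξ : ℝ) : ℂ))) * (φ x : ℂ))‖ := by
  intro t ht y hy1 hy2
  have hM5 : (5:ℝ) ≤ M := by exact_mod_cast hM
  have hm : 1 / (M:ℝ) ≤ 1/5 := by gcongr
  have hm0 : 0 < 1 / (M:ℝ) := by positivity
  have hpi := Real.pi_lt_four
  have hyd : |y| ≤ 1/16 := by linarith
  have h1t : 1 ≤ |y| * t := by rwa [div_le_iff₀ ht] at hy1
  have ht1 : 1 ≤ t := by nlinarith
  obtain ⟨σ, hσ, hyσ⟩ : ∃ σ : ℝ, (σ = 1 ∨ σ = -1) ∧ y = σ * |y| := by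
    rcases le_total 0 y with h | h
    · exact ⟨1, Or.inl rfl, by rw [abs_of_nonneg h]; ring⟩
    · exact ⟨-1, Or.inr rfl, by rw [abs_of_nonpos h]; ring⟩
  have core := slb_core φ hφs hφc hφ0 t y σ (1/(M:ℝ)) ht1 hσ hyσ (by nlinarith) hm
    (fun x hx => by
      have := hsupp (subset_tsupport _ hx)
      exact abs_le.2 ⟨this.1.le, this.2.le⟩)
    (by
      have h2 : 1 ≤ t^2 := by nlinarith
      nlinarith)
  have hcv : ∫ z : ℝ, t * φ (t^2 * z) * |y - z| ^ (-(1/2) : ℝ)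
      = ∫ x, φ x * |y * t^2 - x| ^ (-(1/2) : ℝ) := by
    have h := Measure.integral_comp_mul_left (fun x => φ x * |y * t^2 - x| ^ (-(1/2) : ℝ)) (t^2)
    have ht2 : 0 < t^2 := by positivity
    rw [abs_of_pos (inv_pos.2 ht2), smul_eq_mul] at h
    have h' : ∫ x, φ x * |y * t^2 - x| ^ (-(1/2) : ℝ) =
        t^2 * ∫ z, φ (t^2 * z) * |y * t^2 - t^2 * z| ^ (-(1/2) : ℝ) := by
      rw [h]; field_simp
    rw [h', ← integral_const_mul]
    congr 1; ext z
    have e : |y * t^2 - t^2 * z| ^ (-(1/2) : ℝ) = t⁻¹ * |y - z| ^ (-(1/2) : ℝ) := by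
      rw [show y * t^2 - t^2 * z = t^2 * (y - z) by ring, abs_mul, abs_of_pos ht2,
        Real.mul_rpow ht2.le (abs_nonneg _), Real.rpow_neg ht2.le, ← Real.sqrt_eq_rpow,
        Real.sqrt_sq ht.le]
    rw [e]; field_simp
  rw [hcv]
  exact core
end
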